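/- arXiv:1701.01235 — 9 statements merged into one kernel-verified Lean document; each statement's English description precedes it below -/
import Mathlib

section
/- Suppose A and B are meromorphic functions on ℂ that are periodic with period 1, and suppose the difference equation (Δf(z))² = A(z)(f(z)f(z+1) − B(z)) possesses a meromorphic solution f on ℂ. Then either f(z+2) = f(z) identically, or f satisfies the linear difference equation Δ²f(z) − A(z)Δf(z) − A(z)f(z) = 0 identically. -/
/-- A meromorphic function vanishing on a punctured neighbourhood of a point where it is analytic
vanishes at that point. -/
lemma AnalyticAt.eq_zero_of_meromorphicOrderAt_eq_top {g : ℂ → ℂ} {z : ℂ}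
    (hg : AnalyticAt ℂ g z) (h : meromorphicOrderAt g z = ⊤) : g z = 0 :=
  (hg.frequently_zero_iff_eventually_zero.1
    (meromorphicOrderAt_eq_top_iff.1 h).frequently).self_of_nhds

lemma AnalyticAt.comp_add_const {g : ℂ → ℂ} {z c : ℂ} (hg : AnalyticAt ℂ g (z + c)) :
    AnalyticAt ℂ (fun w ↦ g (w + c)) z :=
  hg.fun_comp (f := fun w ↦ w + c) (by fun_prop)

lemma AnalyticAt.of_comp_add_const {g : ℂ → ℂ} {z c : ℂ}
    (hg : AnalyticAt ℂ (fun w ↦ g (w + c)) z) : AnalyticAt ℂ g (z + c) := by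
  have h := AnalyticAt.comp_add_const (g := fun w ↦ g (w + c)) (z := z + c) (c := -c)
    (by simpa using hg)
  simpa using h

lemma AnalyticAt.add_period {g : ℂ → ℂ} {z c : ℂ} (hper : ∀ w, g (w + c) = g w)
    (hg : AnalyticAt ℂ g z) : AnalyticAt ℂ g (z + c) :=
  AnalyticAt.of_comp_add_const (by simpa only [hper] using hg)

lemma MeromorphicOn.comp_add_const {g : ℂ → ℂ} (hg : MeromorphicOn g Set.univ) (c : ℂ) :
    MeromorphicOn (fun w ↦ g (w + c)) Set.univ := fun z _ ↦
  (hg (z + c) trivial).comp_analyticAt (g := fun w ↦ w + c) (by fun_prop)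

/-- If a product of two meromorphic functions on `ℂ` vanishes near every point, outside the point
itself, then so does one of the two factors. -/
lemma MeromorphicOn.meromorphicOrderAt_eq_top_or_of_mul {g h : ℂ → ℂ}
    (hg : MeromorphicOn g Set.univ) (hh : MeromorphicOn h Set.univ)
    (hgh : ∀ z, meromorphicOrderAt (g * h) z = ⊤) :
    (∀ z, meromorphicOrderAt g z = ⊤) ∨ ∀ z, meromorphicOrderAt h z = ⊤ := by
  by_contra! hne
  obtain ⟨⟨a, ha⟩, b, hb⟩ := hne
  have hb' := hg.meromorphicOrderAt_ne_top_of_isPreconnected isPreconnected_univ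
    (Set.mem_univ a) (Set.mem_univ b) ha
  have := hgh b
  rw [meromorphicOrderAt_mul (hg b trivial) (hh b trivial), WithTop.add_eq_top] at this
  exact this.elim hb' hb


/-- Proposition 4.1: Suppose `A`, `B` are meromorphic on `ℂ` and
1-periodic, and `f` is a meromorphic solution of
`(Δf(z))² = A(z)(f(z)f(z+1) − B(z))`, the equation being understood as an identity
of meromorphic functions (it holds at every point where all functions involved are
analytic).  Then either `f(z+2) = f(z)` identically, or `f` satisfies the linear
difference equation `Δ²f(z) − A(z)Δf(z) − A(z)f(z) = 0` identically. -/
theorem stmt_0 (A B f : ℂ → ℂ)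
    (hA : MeromorphicOn A Set.univ) (hB : MeromorphicOn B Set.univ)
    (hf : MeromorphicOn f Set.univ)
    (hAper : ∀ z : ℂ, A (z + 1) = A z) (hBper : ∀ z : ℂ, B (z + 1) = B z)
    (heq : ∀ z : ℂ, AnalyticAt ℂ A z → AnalyticAt ℂ B z →
      AnalyticAt ℂ f z → AnalyticAt ℂ f (z + 1) →
      (f (z + 1) - f z) ^ 2 = A z * (f z * f (z + 1) - B z)) :
    (∀ z : ℂ, AnalyticAt ℂ f z → AnalyticAt ℂ f (z + 2) → f (z + 2) = f z) ∨
    (∀ z : ℂ, AnalyticAt ℂ A z → AnalyticAt ℂ f z → AnalyticAt ℂ f (z + 1) →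
      AnalyticAt ℂ f (z + 2) →
      (f (z + 2) - 2 * f (z + 1) + f z) - A z * (f (z + 1) - f z) - A z * f z = 0) := by
  have hf1 := hf.comp_add_const 1
  have hf2 := hf.comp_add_const 2
  have hg : MeromorphicOn (fun z ↦ f (z + 2) - f z) Set.univ := hf2.sub hf
  have hh : MeromorphicOn
      (fun z ↦ (f (z + 2) - 2 * f (z + 1) + f z) - A z * (f (z + 1) - f z) - A z * f z)
      Set.univ :=
    (((hf2.sub (MeromorphicOn.mul (fun z _ ↦ .const 2 z) hf1)).add hf).sub
      (hA.mul (hf1.sub hf))).sub (hA.mul hf)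
  refine (hg.meromorphicOrderAt_eq_top_or_of_mul hh fun z ↦ ?_).imp ?_ ?_
  · rw [meromorphicOrderAt_eq_top_iff]
    filter_upwards [(hA z trivial).eventually_analyticAt, (hB z trivial).eventually_analyticAt,
      (hf z trivial).eventually_analyticAt, (hf1 z trivial).eventually_analyticAt,
      (hf2 z trivial).eventually_analyticAt] with w hAw hBw hfw hf1w hf2w
    have h12 : w + 1 + 1 = w + 2 := by ring
    have e0 := heq w hAw hBw hfw hf1w.of_comp_add_const
    have e1 := heq (w + 1) (hAw.add_period hAper) (hBw.add_period hBper)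
      hf1w.of_comp_add_const (h12 ▸ hf2w.of_comp_add_const)
    rw [h12, hAper, hBper] at e1
    simp only [Pi.mul_apply]
    linear_combination e1 - e0
  · intro h z hz hz2
    have hz2 := hz2.comp_add_const
    have h0 := AnalyticAt.eq_zero_of_meromorphicOrderAt_eq_top (hz2.fun_sub hz) (h z)
    exact sub_eq_zero.1 h0
  · intro h z hAz hz hz1 hz2
    have hz1 := hz1.comp_add_const
    have hz2 := hz2.comp_add_const
    have h0 := AnalyticAt.eq_zero_of_meromorphicOrderAt_eq_top (by fun_prop) (h z)
    exact h0
end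

section
/- Let A, B, f : ℂ → ℂ be functions with A(z+1) = A(z) and B(z+1) = B(z) for all z, and suppose (Δf(z))² = A(z)(f(z)f(z+1) − B(z)) holds for all z ∈ ℂ. Then for all z ∈ ℂ, (f(z+2) − f(z)) · ( f(z+1)³ − (2f(z+1) − f(z))B(z) + (B(z) − f(z)f(z+1))f(z+2) ) = 0. -/
/-- If `A`, `B` are 1-periodic and `f` solves
`(Δf(z))² = A(z)(f(z)f(z+1) − B(z))` everywhere, then for all `z`,
`(f(z+2) − f(z)) · (f(z+1)³ − (2f(z+1) − f(z))B(z) + (B(z) − f(z)f(z+1))f(z+2)) = 0`. -/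
theorem stmt_1 (A B f : ℂ → ℂ)
    (hAper : ∀ z : ℂ, A (z + 1) = A z) (hBper : ∀ z : ℂ, B (z + 1) = B z)
    (heq : ∀ z : ℂ, (f (z + 1) - f z) ^ 2 = A z * (f z * f (z + 1) - B z)) :
    ∀ z : ℂ, (f (z + 2) - f z) *
      (f (z + 1) ^ 3 - (2 * f (z + 1) - f z) * B z
        + (B z - f z * f (z + 1)) * f (z + 2)) = 0 := by
  intro z
  have h₁ := heq z
  have h₂ := heq (z + 1)
  rw [hAper, hBper, add_assoc, one_add_one_eq_two] at h₂
  linear_combination (f (z + 1) * f (z + 2) - B z) * h₁ - (f z * f (z + 1) - B z) * h₂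
end

section
/- Suppose A and B are meromorphic functions on ℂ that are periodic with period 1, and suppose the difference equation (Δf(z))² = A(z)(f(z)f(z+1) − B(z)) possesses two distinct transcendental meromorphic solutions f₁ and f₂ such that fⱼ(z+2) ≢ fⱼ(z) for j = 1, 2. Then the Casoratian H(z) = f₁(z)Δf₂(z) − f₂(z)Δf₁(z) is a periodic function of period 1, and f₁, f₂ satisfy the algebraic relation A(z)( (A(z)+4)f₁(z)²f₂(z)² − 2B(z)(f₁(z)² + f₂(z)²) )H(z)² − ( A(z)B(z)(f₁(z)² − f₂(z)²) )² = H(z)⁴. -/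
/-- A meromorphic function (given by its values `f : ℂ → ℂ`) is rational if it agrees
with a quotient of polynomials wherever the denominator does not vanish. -/
def IsRationalFunction (f : ℂ → ℂ) : Prop :=
  ∃ p q : Polynomial ℂ, q ≠ 0 ∧ ∀ z : ℂ, q.eval z ≠ 0 → f z = p.eval z / q.eval z

open Filter Topology

/-- Punctured neighbourhoods are preserved by translations. -/
lemma tendsto_add_const_punctured_nhds (z c : ℂ) :
    Tendsto (fun w : ℂ => w + c) (𝓝[≠] z) (𝓝[≠] (z + c)) := by
  refine tendsto_nhdsWithin_iff.2 ⟨?_, ?_⟩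
  · exact ((continuous_id.add continuous_const).tendsto z).mono_left nhdsWithin_le_nhds
  · filter_upwards [self_mem_nhdsWithin] with w hw
    simpa using hw

/-- An entire-plane meromorphic function is analytic at all nearby translated points. -/
lemma MeromorphicOn.eventually_analyticAt_add {f : ℂ → ℂ} (hf : MeromorphicOn f Set.univ)
    (z c : ℂ) : ∀ᶠ w in 𝓝[≠] z, AnalyticAt ℂ f (w + c) :=
  (tendsto_add_const_punctured_nhds z c).eventually
    (hf (z + c) (Set.mem_univ _)).eventually_analyticAt

/-- Translates of analytic functions are analytic. -/
lemma AnalyticAt.comp_add_right {f : ℂ → ℂ} {z c : ℂ} (hf : AnalyticAt ℂ f (z + c)) :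
    AnalyticAt ℂ (fun w => f (w + c)) z :=
  hf.fun_comp (f := fun w : ℂ => w + c) (by fun_prop)

/-- Periodic functions are analytic at translates of points of analyticity. -/
lemma AnalyticAt.add_one_of_periodic {A : ℂ → ℂ} (hper : ∀ z : ℂ, A (z + 1) = A z) {z : ℂ}
    (hA : AnalyticAt ℂ A z) : AnalyticAt ℂ A (z + 1) := by
  have hshift : (fun w => A (w + (-1))) = A := by
    funext w
    rw [← hper (w + -1)]
    ring_nf
  rw [← hshift]
  exact AnalyticAt.comp_add_right (by simpa using hA)

/-- A meromorphic function that is not `2`-periodic differs from its translate by `2` at all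
nearby points. -/
lemma MeromorphicOn.eventually_add_two_ne {f : ℂ → ℂ} (hf : MeromorphicOn f Set.univ)
    (hnper : ¬ ∀ z : ℂ, AnalyticAt ℂ f z → AnalyticAt ℂ f (z + 2) → f (z + 2) = f z) (z : ℂ) :
    ∀ᶠ w in 𝓝[≠] z, f (w + 2) - f w ≠ 0 := by
  push Not at hnper
  obtain ⟨z₀, h0, h2, hne⟩ := hnper
  have hg : MeromorphicOn (fun w => f (w + 2) - f w) Set.univ := fun w _ =>
    ((hf (w + 2) (Set.mem_univ _)).comp_analyticAt
      (g := fun w : ℂ => w + 2) (by fun_prop)).sub (hf w (Set.mem_univ _))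
  have horder : meromorphicOrderAt (fun w => f (w + 2) - f w) z₀ ≠ ⊤ := by
    rw [meromorphicOrderAt_ne_top_iff_eventually_ne_zero (hg z₀ (Set.mem_univ _))]
    exact ((h2.comp_add_right.sub h0).continuousAt.eventually_ne
      (sub_ne_zero.2 hne)).filter_mono nhdsWithin_le_nhds
  exact (meromorphicOrderAt_ne_top_iff_eventually_ne_zero (hg z (Set.mem_univ _))).1
    (hg.meromorphicOrderAt_ne_top_of_isPreconnected isPreconnected_univ
      (Set.mem_univ _) (Set.mem_univ _) horder)

/-- A solution of the quadratic difference equation which is not `2`-periodic satisfies a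
linear second-order difference equation. -/
lemma eventually_linear_recurrence {A B f : ℂ → ℂ}
    (hA : MeromorphicOn A Set.univ) (hB : MeromorphicOn B Set.univ)
    (hf : MeromorphicOn f Set.univ)
    (hAper : ∀ z : ℂ, A (z + 1) = A z) (hBper : ∀ z : ℂ, B (z + 1) = B z)
    (heq : ∀ z : ℂ, AnalyticAt ℂ A z → AnalyticAt ℂ B z →
      AnalyticAt ℂ f z → AnalyticAt ℂ f (z + 1) →
      (f (z + 1) - f z) ^ 2 = A z * (f z * f (z + 1) - B z))
    (hnper : ¬ ∀ z : ℂ, AnalyticAt ℂ f z → AnalyticAt ℂ f (z + 2) → f (z + 2) = f z) (z : ℂ) :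
    ∀ᶠ w in 𝓝[≠] z, f (w + 2) = (2 + A w) * f (w + 1) - f w := by
  filter_upwards [(hA z (Set.mem_univ _)).eventually_analyticAt,
    (hB z (Set.mem_univ _)).eventually_analyticAt, (hf z (Set.mem_univ _)).eventually_analyticAt,
    hf.eventually_analyticAt_add z 1, hf.eventually_analyticAt_add z 2,
    hf.eventually_add_two_ne hnper z] with w hAw hBw h0 h1 h2 hne
  have htwo : w + 1 + 1 = w + 2 := by ring
  have e0 := heq w hAw hBw h0 h1
  have e1 := heq (w + 1) (hAw.add_one_of_periodic hAper) (hBw.add_one_of_periodic hBper) h1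
    (htwo ▸ h2)
  rw [htwo, hAper, hBper] at e1
  refine mul_left_cancel₀ hne ?_
  linear_combination e1 - e0

/-- Theorem 4.1: Suppose `A`, `B` are 1-periodic meromorphic functions
on `ℂ` and the equation `(Δf(z))² = A(z)(f(z)f(z+1) − B(z))` possesses two distinct
transcendental meromorphic solutions `f₁`, `f₂` with `fⱼ(z+2) ≢ fⱼ(z)`.  All identities
of meromorphic functions are understood to hold at every point where the functions
involved are analytic.  Then the Casoratian `H(z) = f₁(z)Δf₂(z) − f₂(z)Δf₁(z)` is
1-periodic, and `A((A+4)f₁²f₂² − 2B(f₁² + f₂²))H² − (AB(f₁² − f₂²))² = H⁴`. -/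
theorem stmt_3 (A B f₁ f₂ : ℂ → ℂ)
    (hA : MeromorphicOn A Set.univ) (hB : MeromorphicOn B Set.univ)
    (hf₁ : MeromorphicOn f₁ Set.univ) (hf₂ : MeromorphicOn f₂ Set.univ)
    (hAper : ∀ z : ℂ, A (z + 1) = A z) (hBper : ∀ z : ℂ, B (z + 1) = B z)
    (htrans₁ : ¬ IsRationalFunction f₁) (htrans₂ : ¬ IsRationalFunction f₂)
    (hdist : ¬ ∀ z : ℂ, AnalyticAt ℂ f₁ z → AnalyticAt ℂ f₂ z → f₁ z = f₂ z)
    (heq₁ : ∀ z : ℂ, AnalyticAt ℂ A z → AnalyticAt ℂ B z →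
      AnalyticAt ℂ f₁ z → AnalyticAt ℂ f₁ (z + 1) →
      (f₁ (z + 1) - f₁ z) ^ 2 = A z * (f₁ z * f₁ (z + 1) - B z))
    (heq₂ : ∀ z : ℂ, AnalyticAt ℂ A z → AnalyticAt ℂ B z →
      AnalyticAt ℂ f₂ z → AnalyticAt ℂ f₂ (z + 1) →
      (f₂ (z + 1) - f₂ z) ^ 2 = A z * (f₂ z * f₂ (z + 1) - B z))
    (hnper₁ : ¬ ∀ z : ℂ, AnalyticAt ℂ f₁ z → AnalyticAt ℂ f₁ (z + 2) → f₁ (z + 2) = f₁ z)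
    (hnper₂ : ¬ ∀ z : ℂ, AnalyticAt ℂ f₂ z → AnalyticAt ℂ f₂ (z + 2) → f₂ (z + 2) = f₂ z)
    (H : ℂ → ℂ)
    (hH : ∀ z : ℂ, H z = f₁ z * (f₂ (z + 1) - f₂ z) - f₂ z * (f₁ (z + 1) - f₁ z)) :
    (∀ z : ℂ, AnalyticAt ℂ f₁ z → AnalyticAt ℂ f₁ (z + 1) → AnalyticAt ℂ f₁ (z + 2) →
      AnalyticAt ℂ f₂ z → AnalyticAt ℂ f₂ (z + 1) → AnalyticAt ℂ f₂ (z + 2) →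
      H (z + 1) = H z) ∧
    (∀ z : ℂ, AnalyticAt ℂ A z → AnalyticAt ℂ B z →
      AnalyticAt ℂ f₁ z → AnalyticAt ℂ f₁ (z + 1) →
      AnalyticAt ℂ f₂ z → AnalyticAt ℂ f₂ (z + 1) →
      A z * ((A z + 4) * f₁ z ^ 2 * f₂ z ^ 2 - 2 * B z * (f₁ z ^ 2 + f₂ z ^ 2)) * H z ^ 2
        - (A z * B z * (f₁ z ^ 2 - f₂ z ^ 2)) ^ 2 = H z ^ 4) := by
  refine ⟨fun z a0 a1 a2 b0 b1 b2 => ?_, fun z hAz hBz a0 a1 b0 b1 => ?_⟩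
  · have htwo : z + 1 + 1 = z + 2 := by ring
    have hH0 : AnalyticAt ℂ H z := by
      rw [funext hH]
      exact (a0.mul (b1.comp_add_right.sub b0)).sub (b0.mul (a1.comp_add_right.sub a0))
    have hH1 : AnalyticAt ℂ H (z + 1) := by
      rw [← htwo] at a2 b2
      rw [funext hH]
      exact (a1.mul (b2.comp_add_right.sub b1)).sub (b1.mul (a2.comp_add_right.sub a1))
    have hEq : (fun w => H (w + 1)) =ᶠ[𝓝[≠] z] H := by
      filter_upwards [eventually_linear_recurrence hA hB hf₁ hAper hBper heq₁ hnper₁ z,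
        eventually_linear_recurrence hA hB hf₂ hAper hBper heq₂ hnper₂ z] with w h1 h2
      rw [hH, hH, show w + 1 + 1 = w + 2 by ring, h1, h2]
      ring
    exact ((hH1.comp_add_right.continuousAt.eventuallyEq_nhds_iff_eventuallyEq_nhdsNE
      hH0.continuousAt).1 hEq).eq_of_nhds
  · have e1 := heq₁ z hAz hBz a0 a1
    have e2 := heq₂ z hAz hBz b0 b1
    rw [hH]
    set x := f₁ z
    set y := f₁ (z + 1)
    set u := f₂ z
    set v := f₂ (z + 1)
    set a := x * (2 * v - (A z + 2) * u) with ha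
    set b := u * (2 * y - (A z + 2) * x) with hb
    have ha2 : a ^ 2 = x ^ 2 * (A z * (A z + 4) * u ^ 2 - 4 * A z * B z) := by
      rw [ha]
      linear_combination 4 * x ^ 2 * e2
    have hb2 : b ^ 2 = u ^ 2 * (A z * (A z + 4) * x ^ 2 - 4 * A z * B z) := by
      rw [hb]
      linear_combination 4 * u ^ 2 * e1
    have hab : x * (v - u) - u * (y - x) = (a - b) / 2 := by
      rw [ha, hb]
      ring
    rw [hab]
    clear_value a b
    linear_combination (-(1 / 8) * (a - b) ^ 2) * (ha2 + hb2) +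
      (1 / 16) * (4 * A z * B z * (u ^ 2 - x ^ 2) + a ^ 2 - b ^ 2) * (ha2 - hb2)
end

section
/- Let A, B, f₁, f₂ : ℂ → ℂ be functions such that (Δfⱼ(z))² = A(z)(fⱼ(z)fⱼ(z+1) − B(z)) for j = 1, 2 and all z ∈ ℂ, and set H(z) = f₁(z)Δf₂(z) − f₂(z)Δf₁(z). Then for all z ∈ ℂ, A(z)( (A(z)+4)f₁(z)²f₂(z)² − 2B(z)(f₁(z)² + f₂(z)²) )H(z)² − ( A(z)B(z)(f₁(z)² − f₂(z)²) )² = H(z)⁴. -/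
/-- If `f₁`, `f₂` both solve `(Δf(z))² = A(z)(f(z)f(z+1) − B(z))`
everywhere and `H(z) = f₁(z)Δf₂(z) − f₂(z)Δf₁(z)`, then for all `z`,
`A(z)((A(z)+4)f₁²f₂² − 2B(z)(f₁² + f₂²))H² − (A(z)B(z)(f₁² − f₂²))² = H⁴`. -/
theorem stmt_4 (A B f₁ f₂ : ℂ → ℂ)
    (h₁ : ∀ z : ℂ, (f₁ (z + 1) - f₁ z) ^ 2 = A z * (f₁ z * f₁ (z + 1) - B z))
    (h₂ : ∀ z : ℂ, (f₂ (z + 1) - f₂ z) ^ 2 = A z * (f₂ z * f₂ (z + 1) - B z))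
    (H : ℂ → ℂ)
    (hH : ∀ z : ℂ, H z = f₁ z * (f₂ (z + 1) - f₂ z) - f₂ z * (f₁ (z + 1) - f₁ z)) :
    ∀ z : ℂ,
      A z * ((A z + 4) * f₁ z ^ 2 * f₂ z ^ 2 - 2 * B z * (f₁ z ^ 2 + f₂ z ^ 2)) * H z ^ 2
        - (A z * B z * (f₁ z ^ 2 - f₂ z ^ 2)) ^ 2 = H z ^ 4 := by
  intro z
  have hH := hH z
  have h₁ := h₁ z
  have h₂ := h₂ z
  generalize f₁ (z + 1) = x', f₂ (z + 1) = y', f₁ z = x, f₂ z = y, A z = a, B z = b,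
    H z = h at *
  have hdiff : a * b * (x ^ 2 - y ^ 2) =
      h * (a * (x * y) - (x * (y' - y) + y * (x' - x))) := by
    rw [hH]
    linear_combination x ^ 2 * h₂ - y ^ 2 * h₁
  have hsum : (x * (y' - y)) ^ 2 + (y * (x' - x)) ^ 2 =
      a * (x * y * (x * (y' - y) + y * (x' - x)) + 2 * (x * y) ^ 2 - b * (x ^ 2 + y ^ 2)) := by
    linear_combination y ^ 2 * h₁ + x ^ 2 * h₂
  have hsq : h ^ 2 = (x * (y' - y) - y * (x' - x)) ^ 2 := by rw [hH]
  rw [hdiff]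
  linear_combination -2 * h ^ 2 * hsum - h ^ 2 * hsq
end

section
/- For every b ∈ ℂ, the function f_b(z) = (1 + b·e^{πiz} − e^{2πiz})/(e^{2πiz} − 1) satisfies (Δf_b(z))² = −4( f_b(z)f_b(z+1) − 1 ) for every z ∈ ℂ with e^{2πiz} ≠ 1. -/
open Complex

/-- `f_b(z) = (1 + b e^{πiz} − e^{2πiz})/(e^{2πiz} − 1)` satisfies
`(Δf_b(z))² = −4(f_b(z)f_b(z+1) − 1)` wherever `e^{2πiz} ≠ 1`. -/
theorem stmt_7 (b : ℂ) (f : ℂ → ℂ)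
    (hf : ∀ z : ℂ, f z = (1 + b * Complex.exp (Real.pi * Complex.I * z)
        - Complex.exp (2 * Real.pi * Complex.I * z))
      / (Complex.exp (2 * Real.pi * Complex.I * z) - 1)) :
    ∀ z : ℂ, Complex.exp (2 * Real.pi * Complex.I * z) ≠ 1 →
      (f (z + 1) - f z) ^ 2 = -4 * (f z * f (z + 1) - 1) := by
  intro z hz
  have hshift : Complex.exp (Real.pi * Complex.I * (z + 1))
      = -Complex.exp (Real.pi * Complex.I * z) := by
    rw [mul_add, mul_one, Complex.exp_add, Complex.exp_pi_mul_I, mul_neg_one]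
  have hperiod : Complex.exp (2 * Real.pi * Complex.I * (z + 1))
      = Complex.exp (2 * Real.pi * Complex.I * z) := by
    rw [mul_add, mul_one, Complex.exp_add, Complex.exp_two_pi_mul_I, mul_one]
  have hden : Complex.exp (2 * Real.pi * Complex.I * z) - 1 ≠ 0 := sub_ne_zero.mpr hz
  rw [hf (z + 1), hf z, hshift, hperiod]
  generalize Complex.exp (2 * Real.pi * Complex.I * z) = q at hden ⊢
  field_simp
  ring
end

section
/- Let β : ℂ → ℂ satisfy β(z+1) = β(z) for all z ∈ ℂ. Then the function f(z) = (1 − β(z)e^{πiz} + e^{2πiz})/(e^{2πiz} − 1) satisfies (Δf(z))² = −(4β(z)²/(β(z)² − 4)) ( f(z)f(z+1) − 1 ) for every z ∈ ℂ with e^{2πiz} ≠ 1 and β(z)² ≠ 4. -/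
open Complex

/-- For 1-periodic `β`, the function
`f(z) = (1 − β(z)e^{πiz} + e^{2πiz})/(e^{2πiz} − 1)` satisfies
`(Δf(z))² = −(4β(z)²/(β(z)² − 4))(f(z)f(z+1) − 1)` wherever `e^{2πiz} ≠ 1` and
`β(z)² ≠ 4`. -/
theorem stmt_9 (β : ℂ → ℂ) (hβ : ∀ z : ℂ, β (z + 1) = β z) (f : ℂ → ℂ)
    (hf : ∀ z : ℂ, f z = (1 - β z * Complex.exp (Real.pi * Complex.I * z)
        + Complex.exp (2 * Real.pi * Complex.I * z))
      / (Complex.exp (2 * Real.pi * Complex.I * z) - 1)) :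
    ∀ z : ℂ, Complex.exp (2 * Real.pi * Complex.I * z) ≠ 1 → β z ^ 2 ≠ 4 →
      (f (z + 1) - f z) ^ 2 = -(4 * β z ^ 2 / (β z ^ 2 - 4)) * (f z * f (z + 1) - 1) := by
  intro z hz hb
  have hsq : exp (2 * Real.pi * I * z) = exp (Real.pi * I * z) ^ 2 := by
    rw [← exp_nat_mul]
    congr 1
    push_cast
    ring
  have hshift : exp (Real.pi * I * (z + 1)) = -exp (Real.pi * I * z) := by
    rw [mul_add, mul_one, exp_add, exp_pi_mul_I, mul_neg_one]
  have hperiod : exp (2 * Real.pi * I * (z + 1)) = exp (Real.pi * I * z) ^ 2 := by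
    rw [mul_add, mul_one, exp_add, exp_two_pi_mul_I, mul_one, hsq]
  rw [hf (z + 1), hf z, hβ, hshift, hperiod, hsq]
  rw [hsq] at hz
  have hden : exp (Real.pi * I * z) ^ 2 - 1 ≠ 0 := sub_ne_zero.mpr hz
  have hβden : β z ^ 2 - 4 ≠ 0 := sub_ne_zero.mpr hb
  generalize exp (Real.pi * I * z) = e at *
  field_simp
  ring
end

section
/- Let Q : ℂ → ℂ satisfy Q(z+1) = Q(z) for all z ∈ ℂ, and let h : ℂ → ℂ be an arbitrary function. Then the function f(z) = (h(z)² + Q(z)²)/(2h(z)Q(z)) satisfies (Δf(z))² = ((h(z+1) − h(z))²/(h(z)h(z+1))) · ( f(z)f(z+1) − (h(z+1) + h(z))²/(4h(z)h(z+1)) ) for every z ∈ ℂ with h(z) ≠ 0, h(z+1) ≠ 0, and Q(z) ≠ 0. -/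
/-- For 1-periodic `Q` and arbitrary `h`, the function
`f(z) = (h(z)² + Q(z)²)/(2h(z)Q(z))` satisfies
`(Δf(z))² = ((h(z+1)−h(z))²/(h(z)h(z+1)))(f(z)f(z+1) − (h(z+1)+h(z))²/(4h(z)h(z+1)))`
wherever `h(z) ≠ 0`, `h(z+1) ≠ 0`, `Q(z) ≠ 0`. -/
theorem stmt_11 (Q h : ℂ → ℂ) (hQ : ∀ z : ℂ, Q (z + 1) = Q z) (f : ℂ → ℂ)
    (hf : ∀ z : ℂ, f z = (h z ^ 2 + Q z ^ 2) / (2 * h z * Q z)) :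
    ∀ z : ℂ, h z ≠ 0 → h (z + 1) ≠ 0 → Q z ≠ 0 →
      (f (z + 1) - f z) ^ 2 =
        ((h (z + 1) - h z) ^ 2 / (h z * h (z + 1))) *
          (f z * f (z + 1) - (h (z + 1) + h z) ^ 2 / (4 * h z * h (z + 1))) := by
  intro z ha hb hq
  rw [hf (z + 1), hf z, hQ z]
  field_simp
  ring
end

section
/- Let A, B, a, f : ℂ → ℂ be functions such that both a and f satisfy the difference equation, i.e., (Δa(z))² = A(z)(a(z)a(z+1) − B(z)) and (Δf(z))² = A(z)(f(z)f(z+1) − B(z)) for all z ∈ ℂ. Define g(z) = (f(z) − a(z))/(f(z) + a(z)). Then for every z ∈ ℂ with f(z) + a(z) ≠ 0 and f(z+1) + a(z+1) ≠ 0, the quadratic relation C₂(z)(Δg(z))² + C₁(z)Δg(z) + C₀(z) = 0 holds, where C₀(z) = 4A(z)B(z)(g(z) − 1)²g(z), C₁(z) = 2(g(z) − 1)( 2A(z)B(z)(g(z) − 1) + a(z)²A(z)(g(z) + 1) + Δa(z)(A(z) + 2)a(z)(g(z) + 1) ), and C₂(z) = 2a(z)( a(z)A(z) + Δa(z)(A(z)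 + 2) )g(z) − 2a(z)( 2a(z) + a(z)A(z) + Δa(z)(A(z) + 2) ). -/
/-- If `a` and `f` both solve `(Δy(z))² = A(z)(y(z)y(z+1) − B(z))`
and `g(z) = (f(z) − a(z))/(f(z) + a(z))`, then wherever `f(z)+a(z) ≠ 0` and
`f(z+1)+a(z+1) ≠ 0`, the relation `C₂(z)(Δg(z))² + C₁(z)Δg(z) + C₀(z) = 0` holds,
with `C₀ = 4AB(g−1)²g`,
`C₁ = 2(g−1)(2AB(g−1) + a²A(g+1) + Δa(A+2)a(g+1))`, and
`C₂ = 2a(aA + Δa(A+2))g − 2a(2a + aA + Δa(A+2))`. -/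
theorem stmt_17 (A B a f : ℂ → ℂ)
    (ha : ∀ z : ℂ, (a (z + 1) - a z) ^ 2 = A z * (a z * a (z + 1) - B z))
    (hf : ∀ z : ℂ, (f (z + 1) - f z) ^ 2 = A z * (f z * f (z + 1) - B z))
    (g : ℂ → ℂ) (hg : ∀ z : ℂ, g z = (f z - a z) / (f z + a z))
    (C₀ C₁ C₂ : ℂ → ℂ)
    (hC₀ : ∀ z : ℂ, C₀ z = 4 * A z * B z * (g z - 1) ^ 2 * g z)
    (hC₁ : ∀ z : ℂ, C₁ z = 2 * (g z - 1) * (2 * A z * B z * (g z - 1)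
      + a z ^ 2 * A z * (g z + 1)
      + (a (z + 1) - a z) * (A z + 2) * a z * (g z + 1)))
    (hC₂ : ∀ z : ℂ, C₂ z = 2 * a z * (a z * A z + (a (z + 1) - a z) * (A z + 2)) * g z
      - 2 * a z * (2 * a z + a z * A z + (a (z + 1) - a z) * (A z + 2))) :
    ∀ z : ℂ, f z + a z ≠ 0 → f (z + 1) + a (z + 1) ≠ 0 →
      C₂ z * (g (z + 1) - g z) ^ 2 + C₁ z * (g (z + 1) - g z) + C₀ z = 0 := by
  intro z hz hz'
  rw [hC₀, hC₁, hC₂, hg z, hg (z + 1)]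
  have key := congrArg₂ (fun p q : ℂ =>
    ((f z - a z) / (f z + a z) - 1) ^ 2 *
      (((f (z + 1) - a (z + 1)) / (f (z + 1) + a (z + 1)) + 1) ^ 2 * p -
        ((f (z + 1) - a (z + 1)) / (f (z + 1) + a (z + 1)) - 1) ^ 2 * q))
    (sub_eq_zero.mpr (ha z)) (sub_eq_zero.mpr (hf z))
  simp only [mul_zero, sub_self] at key
  rw [← key]
  field_simp
  ring
end

section
/- Let A, B, a, f : ℂ → ℂ be functions such that both a and f satisfy (Δa(z))² = A(z)(a(z)a(z+1) − B(z)) and (Δf(z))² = A(z)(f(z)f(z+1) − B(z)) for all z ∈ ℂ. Define g(z) = (f(z) − a(z))/(f(z) + a(z)) and let C₀, C₁, C₂ be as follows: C₀(z) = 4A(z)B(z)(g(z) − 1)²g(z), C₁(z) = 2(g(z) − 1)( 2A(z)B(z)(g(z) − 1) + a(z)²A(z)(g(z) + 1) + Δa(z)(A(z) + 2)a(z)(g(z) + 1) ), C₂(z) = 2a(z)( a(z)A(z) + Δa(z)(A(z) + 2) )g(z) − 2a(z)( 2a(z) + a(z)A(z) + Δa(z)(A(z) + 2) ). Then for every z ∈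 ℂ with f(z) + a(z) ≠ 0, C₁(z)² − 4C₀(z)C₂(z) = 64 a(z)⁴ a(z+1)² A(z) ( (A(z)+4)f(z)² − 4B(z) ) / (f(z) + a(z))⁴. -/
/-- In the setting of the quadratic relation for
`g(z) = (f(z) − a(z))/(f(z) + a(z))`, the discriminant satisfies
`C₁(z)² − 4C₀(z)C₂(z) = 64 a(z)⁴ a(z+1)² A(z)((A(z)+4)f(z)² − 4B(z))/(f(z)+a(z))⁴`
wherever `f(z) + a(z) ≠ 0`. -/
theorem stmt_18 (A B a f : ℂ → ℂ)
    (ha : ∀ z : ℂ, (a (z + 1) - a z) ^ 2 = A z * (a z * a (z + 1) - B z))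
    (hf : ∀ z : ℂ, (f (z + 1) - f z) ^ 2 = A z * (f z * f (z + 1) - B z))
    (g : ℂ → ℂ) (hg : ∀ z : ℂ, g z = (f z - a z) / (f z + a z))
    (C₀ C₁ C₂ : ℂ → ℂ)
    (hC₀ : ∀ z : ℂ, C₀ z = 4 * A z * B z * (g z - 1) ^ 2 * g z)
    (hC₁ : ∀ z : ℂ, C₁ z = 2 * (g z - 1) * (2 * A z * B z * (g z - 1)
      + a z ^ 2 * A z * (g z + 1)
      + (a (z + 1) - a z) * (A z + 2) * a z * (g z + 1)))
    (hC₂ : ∀ z : ℂ, C₂ z = 2 * a z * (a z * A z + (a (z + 1) - a z) * (A z + 2)) * g z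
      - 2 * a z * (2 * a z + a z * A z + (a (z + 1) - a z) * (A z + 2))) :
    ∀ z : ℂ, f z + a z ≠ 0 →
      C₁ z ^ 2 - 4 * C₀ z * C₂ z =
        64 * a z ^ 4 * a (z + 1) ^ 2 * A z * ((A z + 4) * f z ^ 2 - 4 * B z)
          / (f z + a z) ^ 4 := by
  intro z hs
  have h1 : g z - 1 = -2 * a z / (f z + a z) := by
    rw [hg]
    field_simp
    ring
  have h2 : g z + 1 = 2 * f z / (f z + a z) := by
    rw [hg]
    field_simp
    ring
  have e := ha z
  rw [hC₀, hC₁, hC₂, h1, h2, hg]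
  generalize f z = x at *
  generalize a (z + 1) = b at *
  generalize a z = y at *
  have key : ((y * A z + (b - y) * (A z + 2)) * x - 2 * A z * B z) ^ 2
      + 4 * A z * B z * (x - y) * (y * A z + (b - y) * (A z + 2) + x + y)
      = b ^ 2 * A z * ((A z + 4) * x ^ 2 - 4 * B z) := by
    linear_combination (4 * x ^ 2 + 4 * A z * B z) * e
  rw [eq_div_iff (pow_ne_zero 4 hs)]
  field_simp
  linear_combination 64 * y ^ 4 * key
end
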